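/- arXiv:1901.04078 — 2 statements merged into one kernel-verified Lean document; each statement's English description precedes it below -/
import Mathlib

section
/- Under the stated assumptions (mutually orthogonal receive array response vectors with ‖a_rx(ℓ)‖² = M_rx, and the noise vector Ŵ centered with uncorrelated components of variance N_0/D_2), assume additionally that Z > 0 almost surely and that both Z and |μ† h_k|² E_k / Z are integrable. Then the mean effective SNR satisfies E[ |μ† h_k|² E_k / Z ] ≥ M_rx E^{(r)} e^{−v} |β(f_c, f_k)|² E_k / ( β(0,0) (N_0/D_2) E_k + β(0,0) (N_0 T_cs/T_s) E^{(r)} e^{−v} + N_0² T_cs/(D_2 T_s) ). -/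
open Real Finset MeasureTheory ProbabilityTheory

/-- The conjugate inner product `u† v = Σ_i conj(u_i) v_i`. -/
noncomputable def dotc {M : ℕ} (u v : Fin M → ℂ) : ℂ :=
  ∑ i, (starRingEnd ℂ) (u i) * v i

/-- The frequency-domain channel matrix `Σ_ℓ α_ℓ a_rx(ℓ) a_tx(ℓ)† e^{−2πi f τ_ℓ}`. -/
noncomputable def chanMat {L Mtx Mrx : ℕ} (α : Fin L → ℂ)
    (arx : Fin L → Fin Mrx → ℂ) (atx : Fin L → Fin Mtx → ℂ)
    (τ : Fin L → ℝ) (f : ℝ) : Matrix (Fin Mrx) (Fin Mtx) ℂ :=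
  ∑ ℓ, (α ℓ * Complex.exp (((-(2 * π * f * τ ℓ)) : ℝ) * Complex.I)) •
    Matrix.vecMulVec (arx ℓ) (star (atx ℓ))

/-- The frequency-selective coupling coefficient
`β(ḟ, f̈) = Σ_ℓ |α_ℓ|² |a_tx(ℓ)† t|² e^{i(2π ḟ (τ̂_ℓ − τ_ℓ) − 2π f̈ τ_ℓ)}`. -/
noncomputable def betaCoef {L Mtx : ℕ} (α : Fin L → ℂ) (atx : Fin L → Fin Mtx → ℂ)
    (τhat τ : Fin L → ℝ) (t : Fin Mtx → ℂ) (fdot fddot : ℝ) : ℂ :=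
  ∑ ℓ, ((‖α ℓ‖ ^ 2 * ‖dotc (atx ℓ) t‖ ^ 2 : ℝ) : ℂ) *
    Complex.exp (((2 * π * fdot * (τhat ℓ - τ ℓ) - 2 * π * fddot * τ ℓ) : ℝ) * Complex.I)

/-- `β(0,0) = Σ_ℓ |α_ℓ|² |a_tx(ℓ)† t|²`. -/
noncomputable def betaZero {L Mtx : ℕ} (α : Fin L → ℂ) (atx : Fin L → Fin Mtx → ℂ)
    (t : Fin Mtx → ℂ) : ℝ :=
  ∑ ℓ, ‖α ℓ‖ ^ 2 * ‖dotc (atx ℓ) t‖ ^ 2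

open scoped ComplexConjugate

lemma dotc_self {M : ℕ} (u : Fin M → ℂ) : dotc u u = ((∑ i, ‖u i‖ ^ 2 : ℝ) : ℂ) := by
  simp [dotc, Complex.conj_mul']

lemma dotc_smul_left {M : ℕ} (s : ℂ) (u v : Fin M → ℂ) :
    dotc (fun i => s * u i) v = conj s * dotc u v := by
  simp [dotc, Finset.mul_sum, mul_assoc]

lemma chanMat_mulVec {L Mtx Mrx : ℕ} (α : Fin L → ℂ)
    (arx : Fin L → Fin Mrx → ℂ) (atx : Fin L → Fin Mtx → ℂ)
    (τ : Fin L → ℝ) (f : ℝ) (t : Fin Mtx → ℂ) :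
    (chanMat α arx atx τ f).mulVec t = fun i => ∑ ℓ,
      (α ℓ * Complex.exp (((-(2 * π * f * τ ℓ)) : ℝ) * Complex.I) * dotc (atx ℓ) t)
        * arx ℓ i := by
  ext i
  simp only [chanMat, Matrix.sum_mulVec, Finset.sum_apply, Matrix.smul_mulVec,
    Matrix.vecMulVec_mulVec]
  refine Finset.sum_congr rfl fun ℓ _ => ?_
  simp [dotc, dotProduct]
  ring

lemma dotc_sum_of_orthogonal {L M : ℕ} (e : Fin L → Fin M → ℂ) (c : ℂ)
    (horth : ∀ ℓ m, ℓ ≠ m → dotc (e ℓ) (e m) = 0) (hnorm : ∀ ℓ, dotc (e ℓ) (e ℓ) = c)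
    (a b : Fin L → ℂ) :
    dotc (fun i => ∑ ℓ, a ℓ * e ℓ i) (fun i => ∑ ℓ, b ℓ * e ℓ i)
      = c * ∑ ℓ, conj (a ℓ) * b ℓ := by
  have h : dotc (fun i => ∑ ℓ, a ℓ * e ℓ i) (fun i => ∑ ℓ, b ℓ * e ℓ i)
      = ∑ ℓ, ∑ m, conj (a ℓ) * b m * dotc (e ℓ) (e m) := by
    simp only [dotc, map_sum, map_mul, Finset.sum_mul_sum]
    simp only [Finset.mul_sum]
    rw [Finset.sum_comm]
    refine Finset.sum_congr rfl fun ℓ _ => ?_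
    rw [Finset.sum_comm]
    exact Finset.sum_congr rfl fun m _ => Finset.sum_congr rfl fun i _ => by ring
  rw [h, Finset.mul_sum]
  refine Finset.sum_congr rfl fun ℓ _ => ?_
  rw [Finset.sum_eq_single ℓ (fun m _ hm => by rw [horth ℓ m hm.symm, mul_zero]) (by simp),
    hnorm]
  ring

lemma dotc_chanMat_mulVec {L Mtx Mrx : ℕ} (α : Fin L → ℂ)
    (arx : Fin L → Fin Mrx → ℂ) (atx : Fin L → Fin Mtx → ℂ) (τhat τ : Fin L → ℝ)
    (f g : ℝ) (t : Fin Mtx → ℂ)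
    (horth : ∀ ℓ m, ℓ ≠ m → dotc (arx ℓ) (arx m) = 0)
    (hnorm : ∀ ℓ, dotc (arx ℓ) (arx ℓ) = (Mrx : ℂ)) :
    dotc ((chanMat α arx atx τhat f).mulVec t) ((chanMat α arx atx τ (f + g)).mulVec t)
      = Mrx * betaCoef α atx τhat τ t f g := by
  rw [chanMat_mulVec, chanMat_mulVec, dotc_sum_of_orthogonal arx _ horth hnorm, betaCoef]
  congr 1
  refine Finset.sum_congr rfl fun ℓ _ => ?_
  have hexp : Complex.exp (((2 * π * f * (τhat ℓ - τ ℓ) - 2 * π * g * τ ℓ) : ℝ) * Complex.I)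
      = conj (Complex.exp (((-(2 * π * f * τhat ℓ)) : ℝ) * Complex.I))
        * Complex.exp (((-(2 * π * (f + g) * τ ℓ)) : ℝ) * Complex.I) := by
    rw [← Complex.exp_conj, ← Complex.exp_add]
    congr 1
    simp only [map_mul, Complex.conj_ofReal, Complex.conj_I]
    push_cast
    ring
  rw [hexp]
  push_cast
  rw [← Complex.conj_mul' (α ℓ), ← Complex.conj_mul' (dotc (atx ℓ) t)]
  simp only [map_mul]
  ring

lemma betaCoef_self_zero {L Mtx : ℕ} (α : Fin L → ℂ) (atx : Fin L → Fin Mtx → ℂ)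
    (τ : Fin L → ℝ) (t : Fin Mtx → ℂ) (f : ℝ) :
    betaCoef α atx τ τ t f 0 = (betaZero α atx t : ℂ) := by
  simp [betaCoef, betaZero]

lemma sum_norm_sq_chanMat_mulVec {L Mtx Mrx : ℕ} (α : Fin L → ℂ)
    (arx : Fin L → Fin Mrx → ℂ) (atx : Fin L → Fin Mtx → ℂ) (τ : Fin L → ℝ)
    (f : ℝ) (t : Fin Mtx → ℂ)
    (horth : ∀ ℓ m, ℓ ≠ m → dotc (arx ℓ) (arx m) = 0)
    (hnorm : ∀ ℓ, dotc (arx ℓ) (arx ℓ) = (Mrx : ℂ)) :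
    ∑ i, ‖(chanMat α arx atx τ f).mulVec t i‖ ^ 2 = Mrx * betaZero α atx t := by
  have h := dotc_chanMat_mulVec α arx atx τ τ f 0 t horth hnorm
  rw [add_zero, dotc_self, betaCoef_self_zero] at h
  exact_mod_cast h

lemma betaZero_nonneg {L Mtx : ℕ} (α : Fin L → ℂ) (atx : Fin L → Fin Mtx → ℂ)
    (t : Fin Mtx → ℂ) : 0 ≤ betaZero α atx t :=
  Finset.sum_nonneg fun _ _ => by positivity

section Noise

variable {Ω : Type*} [MeasurableSpace Ω] {P : Measure Ω} {M : ℕ} {W : Ω → Fin M → ℂ} {σ : ℝ}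

lemma integrable_mul_conj_of_memLp {X Y : Ω → ℂ} (hX : MemLp X 2 P) (hY : MemLp Y 2 P) :
    Integrable (fun ω => X ω * conj (Y ω)) P :=
  hX.integrable_mul hY.star

lemma norm_dotc_sq (u v : Fin M → ℂ) :
    ((‖dotc u v‖ ^ 2 : ℝ) : ℂ)
      = ∑ i, ∑ j, conj (v i) * v j * (u i * conj (u j)) := by
  push_cast
  rw [← Complex.conj_mul', dotc, map_sum, Finset.sum_mul_sum]
  refine Finset.sum_congr rfl fun i _ => Finset.sum_congr rfl fun j _ => ?_
  simp only [map_mul, Complex.conj_conj]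
  ring

lemma integrable_norm_dotc_sq (hL2 : ∀ m, MemLp (fun ω => W ω m) 2 P) (h : Fin M → ℂ) :
    Integrable (fun ω => ‖dotc (W ω) h‖ ^ 2) P := by
  have hd : MemLp (fun ω => dotc (W ω) h) 2 P :=
    memLp_finsetSum _ fun i _ => ((hL2 i).star.mul_const (h i))
  exact hd.integrable_norm_pow two_ne_zero

lemma integral_norm_dotc_sq (hL2 : ∀ m, MemLp (fun ω => W ω m) 2 P)
    (hcov : ∀ m n, (∫ ω, W ω m * conj (W ω n) ∂P) = if m = n then (σ : ℂ) else 0)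
    (h : Fin M → ℂ) :
    ∫ ω, ‖dotc (W ω) h‖ ^ 2 ∂P = σ * ∑ i, ‖h i‖ ^ 2 := by
  have hint (i j : Fin M) : Integrable (fun ω => W ω i * conj (W ω j)) P :=
    integrable_mul_conj_of_memLp (hL2 i) (hL2 j)
  rw [← Complex.ofReal_inj, ← integral_complex_ofReal]
  simp only [norm_dotc_sq]
  rw [integral_finsetSum _ fun i _ => integrable_finsetSum _ fun j _ => (hint i j).const_mul _]
  push_cast
  rw [Finset.mul_sum]
  refine Finset.sum_congr rfl fun i _ => ?_
  rw [integral_finsetSum _ fun j _ => (hint i j).const_mul _]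
  simp only [integral_const_mul, hcov, mul_ite, mul_zero, Finset.sum_ite_eq, Finset.mem_univ,
    if_true, Complex.conj_mul']
  ring

lemma integrable_norm_const_add_sq [IsProbabilityMeasure P] {X : Ω → ℂ} (hX : MemLp X 2 P)
    (c : ℂ) : Integrable (fun ω => ‖c + X ω‖ ^ 2) P :=
  ((memLp_const c).add hX).integrable_norm_pow two_ne_zero

lemma integral_norm_const_add_sq [IsProbabilityMeasure P] {X : Ω → ℂ} (hX : MemLp X 2 P)
    (hmean : ∫ ω, X ω ∂P = 0) (hvar : ∫ ω, X ω * conj (X ω) ∂P = (σ : ℂ)) (c : ℂ) :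
    ∫ ω, ‖c + X ω‖ ^ 2 ∂P = ‖c‖ ^ 2 + σ := by
  have hint := hX.integrable one_le_two
  have hexpand (ω : Ω) : ((‖c + X ω‖ ^ 2 : ℝ) : ℂ)
      = c * conj c + c * conj (X ω) + conj c * X ω + X ω * conj (X ω) := by
    push_cast
    rw [← Complex.mul_conj', map_add]
    ring
  have hconj : Integrable (fun ω => conj (X ω)) P := (hX.star).integrable one_le_two
  have hlin : Integrable (fun ω => c * conj c + c * conj (X ω)) P :=
    (integrable_const _).add (hconj.const_mul c)
  have haffine : Integrable (fun ω => c * conj c + c * conj (X ω) + conj c * X ω) P :=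
    hlin.add (hint.const_mul _)
  rw [← Complex.ofReal_inj, ← integral_complex_ofReal]
  simp only [hexpand]
  rw [integral_add haffine (integrable_mul_conj_of_memLp hX hX),
    integral_add hlin (hint.const_mul _),
    integral_add (integrable_const _) (hconj.const_mul c), integral_const, integral_const_mul,
    integral_const_mul, integral_conj, hmean, hvar]
  simp [Complex.mul_conj']

lemma integral_sum_norm_const_add_sq [IsProbabilityMeasure P]
    (hL2 : ∀ m, MemLp (fun ω => W ω m) 2 P) (hmean : ∀ m, ∫ ω, W ω m ∂P = 0)
    (hvar : ∀ m, ∫ ω, W ω m * conj (W ω m) ∂P = (σ : ℂ)) (c : Fin M → ℂ) :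
    ∫ ω, ∑ i, ‖c i + W ω i‖ ^ 2 ∂P = ∑ i, ‖c i‖ ^ 2 + M * σ := by
  rw [integral_finsetSum _ fun i _ => integrable_norm_const_add_sq (hL2 i) (c i)]
  simp only [integral_norm_const_add_sq (hL2 _) (hmean _) (hvar _)]
  simp [Finset.sum_add_distrib]

/-- Jensen's inequality for `z ↦ c / z` on the positive half-line. -/
lemma div_integral_le_integral_div [IsProbabilityMeasure P] {Z : Ω → ℝ} {c : ℝ} (hc : 0 ≤ c)
    (hpos : ∀ᵐ ω ∂P, 0 < Z ω) (hZ : Integrable Z P) (hcZ : Integrable (fun ω => c / Z ω) P)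
    (hm : 0 < ∫ ω, Z ω ∂P) :
    c / ∫ ω, Z ω ∂P ≤ ∫ ω, c / Z ω ∂P := by
  set m := ∫ ω, Z ω ∂P with hm_def
  have htangent : ∫ ω, (2 * c / m - c / m ^ 2 * Z ω) ∂P = c / m := by
    rw [integral_sub (integrable_const _) (hZ.const_mul _), integral_const_mul, ← hm_def]
    simp only [integral_const, probReal_univ, one_smul]
    field_simp
    ring
  rw [← htangent]
  refine integral_mono_ae ((integrable_const _).sub (hZ.const_mul _)) hcZ ?_
  filter_upwards [hpos] with ω hω
  have hdiff : c / Z ω - (2 * c / m - c / m ^ 2 * Z ω) = c * (Z ω - m) ^ 2 / (m ^ 2 * Z ω) := by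
    field_simp
    ring
  have : 0 ≤ c * (Z ω - m) ^ 2 / (m ^ 2 * Z ω) := by positivity
  linarith

end Noise

/-- Theorem 1(a) of the paper: lower bound on the mean effective SNR
`E[|μ† h_k|² E_k / Z]` of PACE-aided beamforming, under mutually orthogonal receive array
response vectors with `‖a_rx(ℓ)‖² = M_rx` and a centered noise vector `Ŵ` with
uncorrelated components of variance `N₀/D₂`. -/
theorem stmt0 {L Mtx Mrx : ℕ} (hL : 0 < L) (hMtx : 0 < Mtx) (hMrx : 0 < Mrx)
    (α : Fin L → ℂ) (arx : Fin L → Fin Mrx → ℂ) (atx : Fin L → Fin Mtx → ℂ)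
    (τhat τ : Fin L → ℝ) (fc fk : ℝ) (t : Fin Mtx → ℂ)
    (horth : ∀ ℓ m, ℓ ≠ m → dotc (arx ℓ) (arx m) = 0)
    (hnorm : ∀ ℓ, dotc (arx ℓ) (arx ℓ) = (Mrx : ℂ))
    {Ω : Type*} [MeasureSpace Ω] [IsProbabilityMeasure (ℙ : Measure Ω)]
    (W : Ω → Fin Mrx → ℂ)
    (N0 D2 Er Ek Tcs Ts v θbar : ℝ)
    (hN0 : 0 < N0) (hD2 : 0 < D2) (hEr : 0 < Er) (hEk : 0 < Ek)
    (hTcs : 0 < Tcs) (hTs : 0 < Ts) (hv : 0 ≤ v)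
    (hWL2 : ∀ m, MemLp (fun ω => W ω m) 2 ℙ)
    (hWmean : ∀ m, (∫ ω, W ω m) = 0)
    (hWcov : ∀ m n, (∫ ω, W ω m * (starRingEnd ℂ) (W ω n))
      = if m = n then ((N0 / D2 : ℝ) : ℂ) else 0)
    (μ : Fin Mrx → ℂ)
    (hμ : μ = fun i => ((Real.sqrt Er : ℝ) : ℂ) * Complex.exp ((-θbar : ℝ) * Complex.I) *
      ((Real.exp (-(v / 2)) : ℝ) : ℂ) * (chanMat α arx atx τhat fc).mulVec t i)
    (hvec : Fin Mrx → ℂ)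
    (hhvec : hvec = (chanMat α arx atx τ (fc + fk)).mulVec t)
    (Z : Ω → ℝ)
    (hZ : Z = fun ω => (∑ i, ‖μ i + W ω i‖ ^ 2) * N0 * Tcs / Ts
      + ‖dotc (W ω) hvec‖ ^ 2 * Ek)
    (hZpos : ∀ᵐ ω, 0 < Z ω)
    (hZint : Integrable Z)
    (hSNRint : Integrable (fun ω => ‖dotc μ hvec‖ ^ 2 * Ek / Z ω)) :
    (∫ ω, ‖dotc μ hvec‖ ^ 2 * Ek / Z ω)
      ≥ Mrx * Er * Real.exp (-v) * ‖betaCoef α atx τhat τ t fc fk‖ ^ 2 * Ek /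
        (betaZero α atx t * (N0 / D2) * Ek
          + betaZero α atx t * (N0 * Tcs / Ts) * Er * Real.exp (-v)
          + N0 ^ 2 * Tcs / (D2 * Ts)) := by
  have hs : ‖((Real.sqrt Er : ℝ) : ℂ) * Complex.exp ((-θbar : ℝ) * Complex.I) *
      ((Real.exp (-(v / 2)) : ℝ) : ℂ)‖ ^ 2 = Er * Real.exp (-v) := by
    rw [norm_mul, norm_mul, Complex.norm_exp_ofReal_mul_I, Complex.norm_real, Complex.norm_real,
      mul_one, mul_pow, norm_eq_abs, norm_eq_abs, sq_abs, sq_abs, Real.sq_sqrt hEr.le,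
      ← Real.exp_nat_mul]
    congr 2
    push_cast
    ring
  have hdot : ‖dotc μ hvec‖ ^ 2
      = Er * Real.exp (-v) * (Mrx * ‖betaCoef α atx τhat τ t fc fk‖) ^ 2 := by
    rw [hμ, hhvec, dotc_smul_left, dotc_chanMat_mulVec α arx atx τhat τ fc fk t horth hnorm,
      norm_mul, mul_pow, RCLike.norm_conj, hs, norm_mul, Complex.norm_natCast]
  have hμsq : ∑ i, ‖μ i‖ ^ 2 = Er * Real.exp (-v) * (Mrx * betaZero α atx t) := by
    rw [← sum_norm_sq_chanMat_mulVec α arx atx τhat fc t horth hnorm, Finset.mul_sum, hμ]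
    simp only [norm_mul _ ((chanMat α arx atx τhat fc).mulVec t _), mul_pow, hs]
  have hhsq : ∑ i, ‖hvec i‖ ^ 2 = Mrx * betaZero α atx t := by
    rw [hhvec, sum_norm_sq_chanMat_mulVec α arx atx τ _ t horth hnorm]
  have hmean : ∫ ω, Z ω = Mrx * (betaZero α atx t * (N0 / D2) * Ek
          + betaZero α atx t * (N0 * Tcs / Ts) * Er * Real.exp (-v)
          + N0 ^ 2 * Tcs / (D2 * Ts)) := by
    have hI : Integrable (fun ω => ∑ i, ‖μ i + W ω i‖ ^ 2) :=
      integrable_finsetSum _ fun i _ => integrable_norm_const_add_sq (hWL2 i) (μ i)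
    rw [hZ, integral_add (((hI.mul_const _).mul_const _).div_const _)
      ((integrable_norm_dotc_sq hWL2 hvec).mul_const _), integral_div, integral_mul_const,
      integral_mul_const, integral_mul_const,
      integral_sum_norm_const_add_sq hWL2 hWmean (fun m => by rw [hWcov m m, if_pos rfl]) μ,
      integral_norm_dotc_sq hWL2 hWcov, hμsq, hhsq]
    field_simp
    ring
  have hMrx' : (0 : ℝ) < Mrx := by exact_mod_cast hMrx
  have hβ := betaZero_nonneg α atx t
  have hden : 0 < betaZero α atx t * (N0 / D2) * Ek
          + betaZero α atx t * (N0 * Tcs / Ts) * Er * Real.exp (-v)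
          + N0 ^ 2 * Tcs / (D2 * Ts) := by positivity
  have hjensen := div_integral_le_integral_div (by positivity) hZpos hZint hSNRint
    (by rw [hmean]; positivity)
  refine ge_iff_le.mpr (le_of_eq_of_le ?_ hjensen)
  rw [hmean, hdot, div_eq_div_iff hden.ne' (by positivity)]
  ring
end

section
/- For all real constants μ > 0, ε > 0, N_0 > 0, P > 0 and G > 0, the improper integral ∫_{−∞}^{∞} (N_0·P·G²/2)·| (2πif + ε) / ( 2πif·μ·(√2·2πif + μ) + (2πif + ε)·P·G ) |² df converges and equals ( (P·G/μ + √2·ε)·(G/μ)·N_0 ) / ( 4·√2·(μ + P·G/μ) ). -/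
open Real MeasureTheory

open Set Filter Topology

lemma quartic_pos {b c : ℝ} (hb : 0 < b) (hc : 0 < c) (x : ℝ) :
    0 < (x ^ 2 - c) ^ 2 + b ^ 2 * x ^ 2 := by
  rcases eq_or_ne x 0 with rfl | hx
  · simpa using pow_pos hc 2
  · positivity

/-- The primitive `arctan ((x - c / x) / b)` of `b (x² + c) / ((x² - c)² + b² x²)` on `(0, ∞)`,
extended continuously to `0`. -/
noncomputable def quarticPrimitive (b c : ℝ) : ℝ → ℝ :=
  Function.update (fun x ↦ arctan ((x - c / x) / b)) 0 (-(π / 2))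

lemma hasDerivAt_quarticPrimitive {b c x : ℝ} (hb : 0 < b) (hc : 0 < c) (hx : 0 < x) :
    HasDerivAt (quarticPrimitive b c) (b * ((x ^ 2 + c) / ((x ^ 2 - c) ^ 2 + b ^ 2 * x ^ 2))) x := by
  have hD := (quartic_pos hb hc x).ne'
  have hinner : HasDerivAt (fun y : ℝ ↦ (y - c / y) / b) ((1 + c / x ^ 2) / b) x := by
    have h := ((hasDerivAt_id x).sub ((hasDerivAt_inv hx.ne').const_mul c)).div_const b
    convert! h using 1
    ring
  have h := hinner.arctan
  have heq : (fun y : ℝ ↦ arctan ((y - c / y) / b)) =ᶠ[𝓝 x] quarticPrimitive b c := by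
    filter_upwards [eventually_ne_nhds hx.ne'] with y hy
    simp [quarticPrimitive, Function.update_of_ne hy]
  refine (h.congr_of_eventuallyEq heq.symm).congr_deriv ?_
  have h1 : 1 + ((x - c / x) / b) ^ 2 =
      ((x ^ 2 - c) ^ 2 + b ^ 2 * x ^ 2) / (b ^ 2 * x ^ 2) := by
    field_simp
    ring
  rw [h1]
  field_simp

lemma continuousWithinAt_quarticPrimitive {b c : ℝ} (hb : 0 < b) (hc : 0 < c) :
    ContinuousWithinAt (quarticPrimitive b c) (Ici 0) 0 := by
  rw [quarticPrimitive, continuousWithinAt_update_same, Ici_sdiff_left]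
  refine (tendsto_arctan_atBot.mono_right nhdsWithin_le_nhds).comp ?_
  refine Tendsto.atBot_div_const hb ?_
  have h0 : Tendsto (fun x : ℝ ↦ x) (𝓝[>] 0) (𝓝 0) := tendsto_id.mono_left nhdsWithin_le_nhds
  have h1 : Tendsto (fun x : ℝ ↦ -(c * x⁻¹)) (𝓝[>] 0) atBot :=
    tendsto_neg_atTop_atBot.comp (tendsto_inv_nhdsGT_zero.const_mul_atTop hc)
  simpa only [sub_eq_add_neg, div_eq_mul_inv] using h0.add_atBot h1

lemma tendsto_quarticPrimitive_atTop {b : ℝ} (c : ℝ) (hb : 0 < b) :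
    Tendsto (quarticPrimitive b c) atTop (𝓝 (π / 2)) := by
  have h : Tendsto (fun x : ℝ ↦ arctan ((x - c / x) / b)) atTop (𝓝 (π / 2)) := by
    refine (tendsto_arctan_atTop.mono_right nhdsWithin_le_nhds).comp ?_
    refine Tendsto.atTop_div_const hb ?_
    have h0 : Tendsto (fun x : ℝ ↦ -(c / x)) atTop (𝓝 (-0)) :=
      (tendsto_const_nhds.div_atTop tendsto_id).neg
    simpa only [sub_eq_add_neg, id] using tendsto_id.atTop_add h0
  refine h.congr' ?_
  filter_upwards [eventually_ne_atTop 0] with y hy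
  simp [quarticPrimitive, Function.update_of_ne hy]

lemma integrableOn_quartic_sum {b c : ℝ} (hb : 0 < b) (hc : 0 < c) :
    IntegrableOn (fun x : ℝ ↦ (x ^ 2 + c) / ((x ^ 2 - c) ^ 2 + b ^ 2 * x ^ 2)) (Ioi 0) := by
  have h := integrableOn_Ioi_deriv_of_nonneg (continuousWithinAt_quarticPrimitive hb hc)
    (fun x hx ↦ hasDerivAt_quarticPrimitive hb hc hx) (fun x _ ↦ by positivity)
    (tendsto_quarticPrimitive_atTop c hb)
  simpa [hb.ne'] using! h.const_mul b⁻¹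

lemma integral_quartic_sum {b c : ℝ} (hb : 0 < b) (hc : 0 < c) :
    ∫ x in Ioi (0 : ℝ), (x ^ 2 + c) / ((x ^ 2 - c) ^ 2 + b ^ 2 * x ^ 2) = π / b := by
  have h := integral_Ioi_of_hasDerivAt_of_nonneg (continuousWithinAt_quarticPrimitive hb hc)
    (fun x hx ↦ hasDerivAt_quarticPrimitive hb hc hx) (fun x _ ↦ by positivity)
    (tendsto_quarticPrimitive_atTop c hb)
  rw [integral_const_mul, quarticPrimitive, Function.update_self] at h
  rw [eq_div_iff hb.ne']
  linarith

lemma continuous_quartic {b c : ℝ} (hb : 0 < b) (hc : 0 < c) (p q : ℝ) :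
    Continuous (fun x : ℝ ↦ (p * x ^ 2 + q) / ((x ^ 2 - c) ^ 2 + b ^ 2 * x ^ 2)) :=
  Continuous.div (by fun_prop) (by fun_prop) fun x ↦ (quartic_pos hb hc x).ne'

lemma integrableOn_quartic_sq {b c : ℝ} (hb : 0 < b) (hc : 0 < c) :
    IntegrableOn (fun x : ℝ ↦ x ^ 2 / ((x ^ 2 - c) ^ 2 + b ^ 2 * x ^ 2)) (Ioi 0) := by
  refine (integrableOn_quartic_sum hb hc).mono'
    (by simpa using (continuous_quartic hb hc 1 0).aestronglyMeasurable)
    (Eventually.of_forall fun x ↦ ?_)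
  have := quartic_pos hb hc x
  rw [norm_of_nonneg (by positivity)]
  gcongr
  linarith

lemma integrableOn_quartic_inv {b c : ℝ} (hb : 0 < b) (hc : 0 < c) :
    IntegrableOn (fun x : ℝ ↦ 1 / ((x ^ 2 - c) ^ 2 + b ^ 2 * x ^ 2)) (Ioi 0) := by
  have h := ((integrableOn_quartic_sum hb hc).sub (integrableOn_quartic_sq hb hc)).const_mul c⁻¹
  refine h.congr (Eventually.of_forall fun x ↦ ?_)
  have := (quartic_pos hb hc x).ne'
  simp only [Pi.sub_apply]
  field_simp
  ring

/-- The substitution `x ↦ c / x` exchanges the two basic integrals. -/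
lemma integral_quartic_inv_eq {b c : ℝ} (hc : 0 < c) :
    ∫ x in Ioi (0 : ℝ), 1 / ((x ^ 2 - c) ^ 2 + b ^ 2 * x ^ 2) =
      c⁻¹ * ∫ x in Ioi (0 : ℝ), x ^ 2 / ((x ^ 2 - c) ^ 2 + b ^ 2 * x ^ 2) := by
  have hscale := integral_comp_mul_left_Ioi
    (fun x : ℝ ↦ x ^ 2 / ((x ^ 2 - c) ^ 2 + b ^ 2 * x ^ 2)) 0 hc
  rw [mul_zero, smul_eq_mul] at hscale
  rw [← hscale, ← integral_comp_rpow_Ioi _ (p := -1) (by norm_num)]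
  refine setIntegral_congr_fun measurableSet_Ioi fun x (hx : 0 < x) ↦ ?_
  have h2 : x ^ (-1 - 1 : ℝ) = (x ^ 2)⁻¹ := by
    rw [show (-1 - 1 : ℝ) = -(2 : ℕ) by norm_num, rpow_neg hx.le, rpow_natCast]
  have hL : ((x⁻¹) ^ 2 - c) ^ 2 + b ^ 2 * (x⁻¹) ^ 2 =
      ((1 - c * x ^ 2) ^ 2 + b ^ 2 * x ^ 2) / x ^ 4 := by
    field_simp
  have hR : ((c * x) ^ 2 - c) ^ 2 + b ^ 2 * (c * x) ^ 2 =
      c ^ 2 * ((1 - c * x ^ 2) ^ 2 + b ^ 2 * x ^ 2) := by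
    ring
  simp only [h2, rpow_neg_one, hL, hR, abs_neg, abs_one, one_mul, smul_eq_mul]
  field_simp

lemma integral_quartic_Ioi {b c : ℝ} (hb : 0 < b) (hc : 0 < c) (e : ℝ) :
    IntegrableOn (fun x : ℝ ↦ (x ^ 2 + e) / ((x ^ 2 - c) ^ 2 + b ^ 2 * x ^ 2)) (Ioi 0) ∧
    ∫ x in Ioi (0 : ℝ), (x ^ 2 + e) / ((x ^ 2 - c) ^ 2 + b ^ 2 * x ^ 2) =
      π * (c + e) / (2 * b * c) := by
  have hi := integrableOn_quartic_sq hb hc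
  have hi' := integrableOn_quartic_inv hb hc
  have hsplit (d : ℝ) : (fun x : ℝ ↦ (x ^ 2 + d) / ((x ^ 2 - c) ^ 2 + b ^ 2 * x ^ 2)) =
      fun x ↦ x ^ 2 / ((x ^ 2 - c) ^ 2 + b ^ 2 * x ^ 2) +
        d * (1 / ((x ^ 2 - c) ^ 2 + b ^ 2 * x ^ 2)) := by
    ext x
    ring
  have hsum := integral_quartic_sum hb hc
  rw [hsplit, integral_add hi (hi'.const_mul c), integral_const_mul,
    integral_quartic_inv_eq hc, mul_inv_cancel_left₀ hc.ne', ← two_mul] at hsum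
  rw [hsplit]
  refine ⟨hi.add (hi'.const_mul e), ?_⟩
  rw [integral_add hi (hi'.const_mul e), integral_const_mul, integral_quartic_inv_eq hc,
    eq_div_of_mul_eq two_ne_zero ((mul_comm _ _).trans hsum)]
  field_simp

lemma integrable_of_even_of_integrableOn_Ioi {g : ℝ → ℝ} (heven : ∀ x, g (-x) = g x)
    (hg : IntegrableOn g (Ioi 0)) : Integrable g := by
  have hIci : IntegrableOn g (Ici 0) := Iff.mpr integrableOn_Ici_iff_integrableOn_Ioi hg
  have hIic : IntegrableOn g (Iic 0) := by
    rw [← neg_zero] at hIci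
    simpa [heven] using hIci.comp_neg_Iic
  rw [← integrableOn_univ, ← Iic_union_Ioi (a := (0 : ℝ))]
  exact hIic.union hg

lemma integral_quartic {b c : ℝ} (hb : 0 < b) (hc : 0 < c) (e : ℝ) :
    Integrable (fun x : ℝ ↦ (x ^ 2 + e) / ((x ^ 2 - c) ^ 2 + b ^ 2 * x ^ 2)) ∧
    ∫ x : ℝ, (x ^ 2 + e) / ((x ^ 2 - c) ^ 2 + b ^ 2 * x ^ 2) = π * (c + e) / (b * c) := by
  obtain ⟨hi, h⟩ := integral_quartic_Ioi hb hc e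
  refine ⟨integrable_of_even_of_integrableOn_Ioi (fun x ↦ by simp) hi, ?_⟩
  have habs := integral_comp_abs
    (f := fun x : ℝ ↦ (x ^ 2 + e) / ((x ^ 2 - c) ^ 2 + b ^ 2 * x ^ 2))
  simp only [sq_abs] at habs
  rw [habs, h]
  field_simp

/-- The squared modulus of `(s + ε) / (a₂ s² + a₁ s + a₀)` at `s = i x`. -/
lemma norm_sq_rational {a₀ a₁ a₂ : ℝ} (ha₂ : a₂ ≠ 0) (ε x : ℝ) :
    ‖(Complex.I * x + ε : ℂ) / (a₂ * (Complex.I * x) ^ 2 + a₁ * (Complex.I * x) + a₀)‖ ^ 2 =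
      (a₂ ^ 2)⁻¹ * ((x ^ 2 + ε ^ 2) /
        ((x ^ 2 - a₀ / a₂) ^ 2 + (a₁ / a₂) ^ 2 * x ^ 2)) := by
  have hnum : (Complex.I * x + ε : ℂ) = (ε : ℂ) + (x : ℂ) * Complex.I := by ring
  have hden : (a₂ * (Complex.I * x) ^ 2 + a₁ * (Complex.I * x) + a₀ : ℂ) =
      ((a₀ - a₂ * x ^ 2 : ℝ) : ℂ) + ((a₁ * x : ℝ) : ℂ) * Complex.I := by
    push_cast
    linear_combination (a₂ * x ^ 2 : ℂ) * Complex.I_sq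
  have hquart : (a₀ - a₂ * x ^ 2) ^ 2 + (a₁ * x) ^ 2 =
      a₂ ^ 2 * ((x ^ 2 - a₀ / a₂) ^ 2 + (a₁ / a₂) ^ 2 * x ^ 2) := by
    field_simp
    ring
  rw [norm_div, div_pow, hnum, hden, ← Complex.normSq_eq_norm_sq, ← Complex.normSq_eq_norm_sq,
    Complex.normSq_add_mul_I, Complex.normSq_add_mul_I, hquart, div_mul_eq_div_div,
    add_comm (ε ^ 2), div_right_comm, div_eq_inv_mul _ (a₂ ^ 2)]

/-- The integral over all frequencies of the locked-state phase-noise power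
spectral density of the weighted carrier-arraying PLL architecture converges and equals
the locked-state phase-noise variance (equations (29)–(30) of the paper), where
`P = |A_rss|²` is the total received reference power, `G = Gᵖ` the primary loop gain,
`μ` the common secondary loop constant and `ε = εᵖ` the primary loop-filter parameter. -/
theorem stmt15 (μ ε N0 P G : ℝ) (hμ : 0 < μ) (hε : 0 < ε) (hN0 : 0 < N0)
    (hP : 0 < P) (hG : 0 < G) :
    Integrable (fun f : ℝ =>
      N0 * P * G ^ 2 / 2 *
        norm ((2 * (π : ℂ) * Complex.I * (f : ℂ) + (ε : ℂ)) /
          (2 * (π : ℂ) * Complex.I * (f : ℂ) * (μ : ℂ) *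
              ((Real.sqrt 2 : ℂ) * (2 * (π : ℂ) * Complex.I * (f : ℂ)) + (μ : ℂ))
            + (2 * (π : ℂ) * Complex.I * (f : ℂ) + (ε : ℂ)) * (P : ℂ) * (G : ℂ))) ^ 2) ∧
    (∫ f : ℝ,
      N0 * P * G ^ 2 / 2 *
        norm ((2 * (π : ℂ) * Complex.I * (f : ℂ) + (ε : ℂ)) /
          (2 * (π : ℂ) * Complex.I * (f : ℂ) * (μ : ℂ) *
              ((Real.sqrt 2 : ℂ) * (2 * (π : ℂ) * Complex.I * (f : ℂ)) + (μ : ℂ))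
            + (2 * (π : ℂ) * Complex.I * (f : ℂ) + (ε : ℂ)) * (P : ℂ) * (G : ℂ))) ^ 2)
      = (P * G / μ + Real.sqrt 2 * ε) * (G / μ) * N0 / (4 * Real.sqrt 2 * (μ + P * G / μ)) := by
  have ha₂ : 0 < √2 * μ := by positivity
  have ha₁ : 0 < μ ^ 2 + P * G := by positivity
  have ha₀ : 0 < ε * (P * G) := by positivity
  obtain ⟨hi, h⟩ := integral_quartic (div_pos ha₁ ha₂) (div_pos ha₀ ha₂) (ε ^ 2)
  have hπ : 2 * π ≠ 0 := by positivity
  have key (f : ℝ) : ‖(2 * (π : ℂ) * Complex.I * (f : ℂ) + (ε : ℂ)) /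
          (2 * (π : ℂ) * Complex.I * (f : ℂ) * (μ : ℂ) *
              ((Real.sqrt 2 : ℂ) * (2 * (π : ℂ) * Complex.I * (f : ℂ)) + (μ : ℂ))
            + (2 * (π : ℂ) * Complex.I * (f : ℂ) + (ε : ℂ)) * (P : ℂ) * (G : ℂ))‖ ^ 2 =
      ((√2 * μ) ^ 2)⁻¹ * (((2 * π * f) ^ 2 + ε ^ 2) /
        (((2 * π * f) ^ 2 - ε * (P * G) / (√2 * μ)) ^ 2 +
          ((μ ^ 2 + P * G) / (√2 * μ)) ^ 2 * (2 * π * f) ^ 2)) := by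
    rw [← norm_sq_rational ha₂.ne']
    congr 3 <;> push_cast <;> ring
  simp only [key]
  refine ⟨((hi.comp_mul_left' hπ).const_mul _).const_mul _, ?_⟩
  rw [integral_const_mul, integral_const_mul, Measure.integral_comp_mul_left
    (fun x : ℝ ↦ (x ^ 2 + ε ^ 2) / ((x ^ 2 - ε * (P * G) / (√2 * μ)) ^ 2 +
      ((μ ^ 2 + P * G) / (√2 * μ)) ^ 2 * x ^ 2)), h, abs_of_pos (by positivity), smul_eq_mul]
  field_simp
  ring
end
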